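/- arXiv:2002.12508 — 5 statements merged into one kernel-verified Lean document; each statement's English description precedes it below -/
import Mathlib

section
/- Let K, N be positive natural numbers, let V be a (KN)×(KN) complex matrix regarded as acting on ℂ^K ⊗ ℂ^N, let R be an N×N complex matrix, and let ε ≥ 0 satisfy ‖(⟨e_0| ⊗ I_N) V (|e_0⟩ ⊗ I_N) − R‖ ≤ ε, where e_0 is the first standard basis vector of ℂ^K. Define W = (H ⊗ I_{KN}) · (|0⟩⟨0| ⊗ I_{KN} + |1⟩⟨1| ⊗ V) · (H ⊗ I_{KN}) acting on ℂ² ⊗ ℂ^K ⊗ ℂ^N, where H is the 2×2 Hadamard matrix. Then ‖(⟨0| ⊗ ⟨e_0| ⊗ I_N) W (|0⟩ ⊗ |e_0⟩ ⊗ I_N) − (I_N + R)/2‖ ≤ ε/2. -/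
open Matrix Kronecker

/-- The ℓ²→ℓ² (spectral) operator norm of a complex square matrix. -/
noncomputable def l2OpNorm {N : ℕ} (M : Matrix (Fin N) (Fin N) ℂ) : ℝ :=
  ‖Matrix.toEuclideanCLM (𝕜 := ℂ) M‖

/-- If `V` is an `(·, ·, ε)`-block-encoding of `R` (its top-left `N×N` block is `ε`-close to `R`
in spectral norm), then the circuit `W = (H ⊗ I)(|0⟩⟨0| ⊗ I + |1⟩⟨1| ⊗ V)(H ⊗ I)` is a
block-encoding of the projector `(I + R)/2` with error `ε/2` (Section 2 of the paper). -/
theorem stmt_2 {K N : ℕ} (hK : 0 < K) (hN : 0 < N)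
    (V : Matrix (Fin K × Fin N) (Fin K × Fin N) ℂ)
    (R : Matrix (Fin N) (Fin N) ℂ) (ε : ℝ) (hε : 0 ≤ ε)
    (hblock : l2OpNorm (Matrix.of (fun i j => V (⟨0, hK⟩, i) (⟨0, hK⟩, j)) - R) ≤ ε)
    (Hd : Matrix (Fin 2) (Fin 2) ℂ)
    (hHd : Hd = (((Real.sqrt 2)⁻¹ : ℝ) : ℂ) • !![1, 1; 1, -1])
    (W : Matrix (Fin 2 × Fin K × Fin N) (Fin 2 × Fin K × Fin N) ℂ)
    (hW : W = (Hd ⊗ₖ (1 : Matrix (Fin K × Fin N) (Fin K × Fin N) ℂ)) *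
        ((!![1, 0; 0, 0] : Matrix (Fin 2) (Fin 2) ℂ) ⊗ₖ (1 : Matrix (Fin K × Fin N) (Fin K × Fin N) ℂ)
          + (!![0, 0; 0, 1] : Matrix (Fin 2) (Fin 2) ℂ) ⊗ₖ V) *
        (Hd ⊗ₖ (1 : Matrix (Fin K × Fin N) (Fin K × Fin N) ℂ))) :
    l2OpNorm (Matrix.of (fun i j => W (0, ⟨0, hK⟩, i) (0, ⟨0, hK⟩, j))
        - (2:ℂ)⁻¹ • (1 + R)) ≤ ε / 2 := by
  have hs : ((((Real.sqrt 2)⁻¹ : ℝ) : ℂ)) * (((Real.sqrt 2)⁻¹ : ℝ) : ℂ) = 2⁻¹ := by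
    rw [← Complex.ofReal_mul, ← mul_inv, Real.mul_self_sqrt (by norm_num)]
    norm_num
  have hP : (Hd * (!![1, 0; 0, 0] : Matrix (Fin 2) (Fin 2) ℂ) * Hd) 0 0 = 2⁻¹ := by
    simpa [hHd, Matrix.mul_apply, Fin.sum_univ_two] using hs
  have hQ : (Hd * (!![0, 0; 0, 1] : Matrix (Fin 2) (Fin 2) ℂ) * Hd) 0 0 = 2⁻¹ := by
    simpa [hHd, Matrix.mul_apply, Fin.sum_univ_two] using hs
  have hW' : W = (Hd * !![1, 0; 0, 0] * Hd) ⊗ₖ 1 + (Hd * !![0, 0; 0, 1] * Hd) ⊗ₖ V := by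
    simp only [hW, mul_add, add_mul, ← Matrix.mul_kronecker_mul, one_mul, mul_one]
  have key : Matrix.of (fun i j => W (0, ⟨0, hK⟩, i) (0, ⟨0, hK⟩, j)) - (2:ℂ)⁻¹ • (1 + R)
      = (2:ℂ)⁻¹ • (Matrix.of (fun i j => V (⟨0, hK⟩, i) (⟨0, hK⟩, j)) - R) := by
    ext i j
    simp only [hW', Matrix.sub_apply, Matrix.of_apply, Matrix.add_apply, Matrix.smul_apply,
      Matrix.kroneckerMap_apply, hP, hQ, Matrix.one_apply, Prod.mk.injEq, true_and, smul_eq_mul]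
    ring
  have hnorm : ‖(2:ℂ)⁻¹‖ = 2⁻¹ := by simp
  unfold l2OpNorm at hblock ⊢
  rw [key, map_smul, norm_smul, hnorm]
  linarith
end

section
/- Let N ≥ 2 be a natural number. In ℂ^N, let u = (1/√N)·Σ_s e_s be the uniform superposition of the standard basis vectors, fix an index t with standard basis vector e_t, and define D = I − 2uu*, U_t = I − 2e_t e_t*, and H(τ) = (1−τ)D + τU_t for τ ∈ ℝ. Then H(1/2)(u + e_t) = −(1/√N)(u + e_t) and H(1/2)(u − e_t) = (1/√N)(u − e_t). -/
open Matrix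

/-- Eigenvectors of `H(1/2)` for the unstructured search problem (proof of Theorem 5.1):
`H(1/2)(u + e_t) = −(1/√N)(u + e_t)` and `H(1/2)(u − e_t) = (1/√N)(u − e_t)`. -/
theorem stmt_10 {N : ℕ} (hN : 2 ≤ N) (t : Fin N)
    (u et : Fin N → ℂ)
    (hu : u = fun _ => (((Real.sqrt N)⁻¹ : ℝ) : ℂ))
    (het : et = Pi.single t 1)
    (D Ut : Matrix (Fin N) (Fin N) ℂ)
    (hD : D = 1 - (2 : ℂ) • vecMulVec u (star u))
    (hUt : Ut = 1 - (2 : ℂ) • vecMulVec et (star et))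
    (Hm : ℝ → Matrix (Fin N) (Fin N) ℂ)
    (hHm : ∀ τ : ℝ, Hm τ = (((1 - τ : ℝ)) : ℂ) • D + ((τ : ℝ) : ℂ) • Ut) :
    (Hm (1/2)).mulVec (u + et) = ((-(Real.sqrt N)⁻¹ : ℝ) : ℂ) • (u + et) ∧
    (Hm (1/2)).mulVec (u - et) = (((Real.sqrt N)⁻¹ : ℝ) : ℂ) • (u - et) := by
  have hN0 : (0 : ℝ) < N := by exact_mod_cast (by omega : 0 < N)
  have huu : star u ⬝ᵥ u = 1 := by
    have h : (N : ℝ) * ((Real.sqrt N)⁻¹ * (Real.sqrt N)⁻¹) = 1 := by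
      rw [← mul_inv, Real.mul_self_sqrt hN0.le, mul_inv_cancel₀ hN0.ne']
    rw [hu]
    simp only [dotProduct, Pi.star_apply, Complex.star_def, Complex.conj_ofReal,
      Finset.sum_const, Finset.card_univ, Fintype.card_fin, nsmul_eq_mul]
    exact_mod_cast h
  have hue : star u ⬝ᵥ et = (((Real.sqrt N)⁻¹ : ℝ) : ℂ) := by
    rw [hu, het, dotProduct_single, mul_one, Pi.star_apply, Complex.star_def, Complex.conj_ofReal]
  have heu : star et ⬝ᵥ u = (((Real.sqrt N)⁻¹ : ℝ) : ℂ) := by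
    rw [hu, het, ← Pi.single_star, star_one, single_dotProduct, one_mul]
  have hee : star et ⬝ᵥ et = 1 := by
    rw [het, ← Pi.single_star, star_one, single_dotProduct, one_mul, Pi.single_eq_same]
  have hH (v : Fin N → ℂ) :
      (Hm (1/2)).mulVec v = v - (star u ⬝ᵥ v) • u - (star et ⬝ᵥ v) • et := by
    rw [hHm, hD, hUt]
    simp only [add_mulVec, sub_mulVec, smul_mulVec, one_mulVec, vecMulVec_mulVec,
      op_smul_eq_smul]
    push_cast
    module
  constructor
  · rw [hH, dotProduct_add, dotProduct_add, huu, hue, heu, hee]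
    push_cast
    module
  · rw [hH, dotProduct_sub, dotProduct_sub, huu, hue, heu, hee]
    module
end

section
/- Let N ≥ 2 be a natural number. In ℂ^N, let u = (1/√N)·Σ_s e_s be the uniform superposition of the standard basis vectors, fix an index t with standard basis vector e_t, and define D = I − 2uu*, U_t = I − 2e_t e_t*, and H(τ) = (1−τ)D + τU_t for τ ∈ ℝ. Then −1/√N is an eigenvalue of H(1/2), and every eigenvalue μ of H(1/2) satisfies μ = −1/√N or μ ≥ 1/√N. In particular the spectral gap of H(1/2) between its smallest and second smallest eigenvalue is 2/√N. -/
open Matrix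

/-- The average of the two reflections `1 - 2 u u*` and `1 - 2 w w*`, applied to a vector. -/
theorem average_reflections_mulVec {n : Type*} [Fintype n] [DecidableEq n] (u w v : n → ℂ) :
    (1 - vecMulVec u (star u) - vecMulVec w (star w)) *ᵥ v =
      v - (star u ⬝ᵥ v) • u - (star w ⬝ᵥ v) • w := by
  simp [sub_mulVec, vecMulVec_mulVec]

theorem hasEigenvalue_toLin'_iff {n : Type*} [Fintype n] [DecidableEq n]
    (A : Matrix n n ℂ) (μ : ℂ) :
    Module.End.HasEigenvalue (Matrix.toLin' A) μ ↔ ∃ v, A *ᵥ v = μ • v ∧ v ≠ 0 := by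
  constructor
  · intro h
    obtain ⟨v, hv⟩ := h.exists_hasEigenvector
    exact ⟨v, by simpa using hv.apply_eq_smul, hv.2⟩
  · rintro ⟨v, hv, hv0⟩
    exact Module.End.hasEigenvalue_of_hasEigenvector
      (Module.End.hasEigenvector_iff.mpr
        ⟨Module.End.mem_eigenspace_iff.mpr (by simpa using hv), hv0⟩)

section

variable {n : Type*} [Fintype n] [DecidableEq n] {u w : n → ℂ} {a : ℂ}

theorem average_reflections_mulVec_add (huu : star u ⬝ᵥ u = 1) (hww : star w ⬝ᵥ w = 1)
    (huw : star u ⬝ᵥ w = a) (hwu : star w ⬝ᵥ u = a) :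
    (1 - vecMulVec u (star u) - vecMulVec w (star w)) *ᵥ (u + w) = (-a) • (u + w) := by
  rw [average_reflections_mulVec, dotProduct_add, dotProduct_add, huu, hww, huw, hwu]
  module

theorem average_reflections_mulVec_sub (huu : star u ⬝ᵥ u = 1) (hww : star w ⬝ᵥ w = 1)
    (huw : star u ⬝ᵥ w = a) (hwu : star w ⬝ᵥ u = a) :
    (1 - vecMulVec u (star u) - vecMulVec w (star w)) *ᵥ (u - w) = a • (u - w) := by
  rw [average_reflections_mulVec, dotProduct_sub, dotProduct_sub, huu, hww, huw, hwu]
  module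

/-- The only possible eigenvalues of the average of two reflections along unit vectors with
real overlap `a` are `-a`, `a` and `1`. -/
theorem eigenvalue_average_reflections (huu : star u ⬝ᵥ u = 1) (hww : star w ⬝ᵥ w = 1)
    (huw : star u ⬝ᵥ w = a) (hwu : star w ⬝ᵥ u = a) {v : n → ℂ} {μ : ℂ} (hv0 : v ≠ 0)
    (hv : (1 - vecMulVec u (star u) - vecMulVec w (star w)) *ᵥ v = μ • v) :
    μ = -a ∨ μ = a ∨ μ = 1 := by
  rw [average_reflections_mulVec] at hv
  have h₁ := congrArg (star u ⬝ᵥ ·) hv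
  have h₂ := congrArg (star w ⬝ᵥ ·) hv
  simp only [dotProduct_sub, dotProduct_smul, huu, hww, huw, hwu, smul_eq_mul] at h₁ h₂
  set p := star u ⬝ᵥ v
  set q := star w ⬝ᵥ v
  by_cases hs : p + q = 0
  · by_cases hd : p - q = 0
    · have hp : p = 0 := by linear_combination (hs + hd) / 2
      have hq : q = 0 := by linear_combination (hs - hd) / 2
      rw [hp, hq, zero_smul, zero_smul, sub_zero, sub_zero] at hv
      refine Or.inr (Or.inr (smul_left_injective ℂ hv0 ?_))
      simpa using hv.symm
    · refine Or.inr (Or.inl (mul_right_cancel₀ hd ?_))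
      linear_combination h₂ - h₁
  · refine Or.inl (mul_right_cancel₀ hs ?_)
    linear_combination -h₁ - h₂

end

/-- Spectrum of `H(1/2)` for the unstructured search problem (proof of Theorem 5.1):
`−1/√N` is an eigenvalue, `1/√N` is an eigenvalue, and every eigenvalue `μ` satisfies
`μ = −1/√N` or `μ` is real with `μ ≥ 1/√N`; hence the spectral gap is `2/√N`. -/
theorem stmt_11 {N : ℕ} (hN : 2 ≤ N) (t : Fin N)
    (u et : Fin N → ℂ)
    (hu : u = fun _ => (((Real.sqrt N)⁻¹ : ℝ) : ℂ))
    (het : et = Pi.single t 1)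
    (D Ut : Matrix (Fin N) (Fin N) ℂ)
    (hD : D = 1 - (2 : ℂ) • vecMulVec u (star u))
    (hUt : Ut = 1 - (2 : ℂ) • vecMulVec et (star et))
    (Hm : ℝ → Matrix (Fin N) (Fin N) ℂ)
    (hHm : ∀ τ : ℝ, Hm τ = (((1 - τ : ℝ)) : ℂ) • D + ((τ : ℝ) : ℂ) • Ut) :
    Module.End.HasEigenvalue (Matrix.toLin' (Hm (1/2))) ((-(Real.sqrt N)⁻¹ : ℝ) : ℂ) ∧
    Module.End.HasEigenvalue (Matrix.toLin' (Hm (1/2))) (((Real.sqrt N)⁻¹ : ℝ) : ℂ) ∧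
    ∀ μ : ℂ, Module.End.HasEigenvalue (Matrix.toLin' (Hm (1/2))) μ →
      μ = ((-(Real.sqrt N)⁻¹ : ℝ) : ℂ) ∨ ∃ r : ℝ, μ = (r : ℂ) ∧ (Real.sqrt N)⁻¹ ≤ r := by
  have hN0 : (0 : ℝ) < N := by exact_mod_cast (by omega : 0 < N)
  have hpos : 0 < (Real.sqrt N)⁻¹ := inv_pos.mpr (Real.sqrt_pos.mpr hN0)
  have hsq : (N : ℝ) * ((Real.sqrt N)⁻¹ * (Real.sqrt N)⁻¹) = 1 := by
    rw [← mul_inv, Real.mul_self_sqrt hN0.le, mul_inv_cancel₀ hN0.ne']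
  have hle : (Real.sqrt N)⁻¹ ≤ 1 := by
    refine inv_le_one_of_one_le₀ (Real.one_le_sqrt.mpr ?_)
    exact_mod_cast (by omega : 1 ≤ N)
  have hH : Hm (1 / 2) = 1 - vecMulVec u (star u) - vecMulVec et (star et) := by
    rw [hHm, hD, hUt]
    push_cast
    module
  rw [hH]
  generalize (Real.sqrt N)⁻¹ = a at *
  have huu : star u ⬝ᵥ u = 1 := by
    have : (N : ℂ) * ((a : ℂ) * a) = 1 := by exact_mod_cast hsq
    simpa [hu, dotProduct] using this
  have hww : star et ⬝ᵥ et = 1 := by simp [het]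
  have huw : star u ⬝ᵥ et = (a : ℂ) := by simp [het, hu]
  have hwu : star et ⬝ᵥ u = (a : ℂ) := by simp [het, hu]
  have ha : (a : ℂ) ≠ 0 := by exact_mod_cast hpos.ne'
  have : Nontrivial (Fin N) := Fin.nontrivial_iff_two_le.mpr hN
  obtain ⟨s, hs⟩ := exists_ne t
  simp only [hasEigenvalue_toLin'_iff]
  refine ⟨⟨u + et, ?_, fun h => ha ?_⟩, ⟨u - et, ?_, fun h => ha ?_⟩, ?_⟩
  · rw [Complex.ofReal_neg]
    exact average_reflections_mulVec_add huu hww huw hwu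
  · simpa [hu, het, hs] using congrFun h s
  · exact average_reflections_mulVec_sub huu hww huw hwu
  · simpa [hu, het, hs] using congrFun h s
  · rintro μ ⟨v, hv, hv0⟩
    rcases eigenvalue_average_reflections huu hww huw hwu hv0 hv with h | h | h
    · exact Or.inl (by rw [h, Complex.ofReal_neg])
    · exact Or.inr ⟨a, h, le_rfl⟩
    · exact Or.inr ⟨1, by rw [h, Complex.ofReal_one], hle⟩
end

section
/- Let N ≥ 2 be a natural number and 0 < δ < 1/6 a real number. In ℂ^N, let u = (1/√N)·Σ_s e_s be the uniform superposition of the standard basis vectors, fix an index t with standard basis vector e_t, and define D = I − 2uu*, U_t = I − 2e_t e_t*, and H(τ) = (1−τ)D + τU_t for τ ∈ ℝ. Let τ_δ = 1/2 − N^{δ−1/2} and λ̃ = √(4 + N^{−2δ} − 4N^{−1}). Then the vectors χ_− = (N^{−δ} + 2N^{−1/2})·u + (−2 + λ̃)·e_t and χ_+ = (N^{−δ} + 2N^{−1/2})·u + (−2 − λ̃)·e_t are nonzero and satisfy H(τ_δ)χ_− = −N^{δ−1/2}·λ̃·χ_− and H(τ_δ)χ_+ = +N^{δ−1/2}·λ̃·χ_+.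 -/
open Matrix

theorem one_sub_two_smul_vecMulVec_star_mulVec {n : Type*} [Fintype n] [DecidableEq n]
    (v w : n → ℂ) :
    (1 - (2 : ℂ) • vecMulVec v (star v)) *ᵥ w = w - (2 * (star v ⬝ᵥ w)) • v := by
  rw [sub_mulVec, one_mulVec, smul_mulVec, vecMulVec_mulVec, op_smul_eq_smul, smul_smul]

/-- Eigenvectors of an interpolation between the reflections along two unit vectors with symmetric
overlap `r = p * a`. -/
theorem interpolated_reflections_mulVec {n : Type*} [Fintype n] [DecidableEq n]
    {u e : n → ℂ} {r p a s : ℂ}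
    (huu : star u ⬝ᵥ u = 1) (hee : star e ⬝ᵥ e = 1)
    (hue : star u ⬝ᵥ e = r) (heu : star e ⬝ᵥ u = r)
    (hpa : p * a = r) (hs : s ^ 2 = 4 + a ^ 2 - 4 * r ^ 2) :
    ((1 / 2 + p) • (1 - (2 : ℂ) • vecMulVec u (star u)) +
        (1 / 2 - p) • (1 - (2 : ℂ) • vecMulVec e (star e))) *ᵥ
        ((a + 2 * r) • u + (-2 + s) • e) =
      (-(p * s)) • ((a + 2 * r) • u + (-2 + s) • e) := by
  simp only [add_mulVec, smul_mulVec, one_sub_two_smul_vecMulVec_star_mulVec, dotProduct_add,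
    dotProduct_smul, huu, hee, hue, heu]
  ext i
  simp only [Pi.add_apply, Pi.smul_apply, Pi.sub_apply, smul_eq_mul]
  linear_combination (p * e i) * hs +
    ((-2 + s) * u i + (a + 2 * r) * e i) * hpa

/-- Eigenvalue–eigenvector computation of Appendix B of the paper: with
`τ_δ = 1/2 − N^{δ−1/2}` and `λ̃ = √(4 + N^{−2δ} − 4N^{−1})`, the vectors
`χ_± = (N^{−δ} + 2N^{−1/2})·u + (−2 ∓ λ̃)·e_t` are nonzero eigenvectors of `H(τ_δ)` with
eigenvalues `∓N^{δ−1/2}·λ̃`. -/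
theorem stmt_13 {N : ℕ} (hN : 2 ≤ N) (δ : ℝ) (hδ : 0 < δ) (hδ' : δ < 1/6) (t : Fin N)
    (u et : Fin N → ℂ)
    (hu : u = fun _ => (((Real.sqrt N)⁻¹ : ℝ) : ℂ))
    (het : et = Pi.single t 1)
    (D Ut : Matrix (Fin N) (Fin N) ℂ)
    (hD : D = 1 - (2 : ℂ) • vecMulVec u (star u))
    (hUt : Ut = 1 - (2 : ℂ) • vecMulVec et (star et))
    (Hm : ℝ → Matrix (Fin N) (Fin N) ℂ)
    (hHm : ∀ τ : ℝ, Hm τ = (((1 - τ : ℝ)) : ℂ) • D + ((τ : ℝ) : ℂ) • Ut)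
    (τδ lamt : ℝ)
    (hτδ : τδ = 1/2 - (N : ℝ) ^ (δ - 1/2 : ℝ))
    (hlamt : lamt = Real.sqrt (4 + (N : ℝ) ^ (-(2 * δ) : ℝ) - 4 * (N : ℝ)⁻¹))
    (χm χp : Fin N → ℂ)
    (hχm : χm = (((N : ℝ) ^ (-δ : ℝ) + 2 * (N : ℝ) ^ (-(1:ℝ)/2 : ℝ) : ℝ) : ℂ) • u
        + (((-2 + lamt : ℝ)) : ℂ) • et)
    (hχp : χp = (((N : ℝ) ^ (-δ : ℝ) + 2 * (N : ℝ) ^ (-(1:ℝ)/2 : ℝ) : ℝ) : ℂ) • u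
        + (((-2 - lamt : ℝ)) : ℂ) • et) :
    χm ≠ 0 ∧ χp ≠ 0 ∧
    (Hm τδ).mulVec χm = ((-((N : ℝ) ^ (δ - 1/2 : ℝ) * lamt) : ℝ) : ℂ) • χm ∧
    (Hm τδ).mulVec χp = (((N : ℝ) ^ (δ - 1/2 : ℝ) * lamt : ℝ) : ℂ) • χp := by
  have hN0 : (0 : ℝ) < N := by exact_mod_cast (by lia : 0 < N)
  set r : ℝ := (N : ℝ) ^ (-(1:ℝ)/2 : ℝ) with hr
  set a : ℝ := (N : ℝ) ^ (-δ : ℝ) with ha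
  set p : ℝ := (N : ℝ) ^ (δ - 1/2 : ℝ) with hp
  have hr_pos : 0 < r := Real.rpow_pos_of_pos hN0 _
  have ha_pos : 0 < a := Real.rpow_pos_of_pos hN0 _
  have hr_sq : r ^ 2 = (N : ℝ)⁻¹ := by
    rw [hr, ← Real.rpow_natCast, ← Real.rpow_mul hN0.le, ← Real.rpow_neg_one]
    norm_num
  have ha_sq : (N : ℝ) ^ (-(2 * δ) : ℝ) = a ^ 2 := by
    rw [ha, ← Real.rpow_natCast, ← Real.rpow_mul hN0.le]
    congr 1
    push_cast
    ring
  have hpa : p * a = r := by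
    rw [hp, ha, hr, ← Real.rpow_add hN0]
    congr 1
    ring
  have hr_sqrt : (Real.sqrt N)⁻¹ = r := by
    rw [← Real.sqrt_inv, ← hr_sq, Real.sqrt_sq hr_pos.le]
  have hN_inv : (N : ℝ)⁻¹ ≤ 1 / 2 := by
    rw [one_div]
    exact inv_anti₀ two_pos (by exact_mod_cast hN)
  have hlam_sq : lamt ^ 2 = 4 + a ^ 2 - 4 * r ^ 2 := by
    rw [hlamt, ha_sq, hr_sq, Real.sq_sqrt (by nlinarith [sq_nonneg a])]
  rw [hr_sqrt] at hu
  have huu : star u ⬝ᵥ u = 1 := by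
    have h : (N : ℝ) * (r * r) = 1 := by
      rw [← sq, hr_sq, mul_inv_cancel₀ hN0.ne']
    simp only [hu, dotProduct, Pi.star_apply, RCLike.star_def, Complex.conj_ofReal,
      Finset.sum_const, Finset.card_univ, Fintype.card_fin, nsmul_eq_mul]
    exact_mod_cast h
  have hee : star et ⬝ᵥ et = 1 := by simp [het]
  have hue : star u ⬝ᵥ et = (r : ℂ) := by simp [het, hu]
  have heu : star et ⬝ᵥ u = (r : ℂ) := by simp [het, hu]
  have hH : Hm τδ = (1 / 2 + (p : ℂ)) • (1 - (2 : ℂ) • vecMulVec u (star u)) +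
      (1 / 2 - (p : ℂ)) • (1 - (2 : ℂ) • vecMulVec et (star et)) := by
    rw [hHm, hD, hUt, hτδ]
    congr 2 <;> push_cast <;> ring
  have hpaC : (p : ℂ) * a = r := by exact_mod_cast hpa
  have hlam_sqC : (lamt : ℂ) ^ 2 = 4 + (a : ℂ) ^ 2 - 4 * (r : ℂ) ^ 2 := by
    exact_mod_cast hlam_sq
  have h_ne (b : ℂ) : ((a + 2 * r : ℝ) : ℂ) • u + b • et ≠ 0 := by
    have : Nontrivial (Fin N) := Fin.nontrivial_iff_two_le.mpr hN
    obtain ⟨j, hj⟩ := exists_ne t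
    intro h
    have hj0 := congrFun h j
    simp only [hu, het, Pi.add_apply, Pi.smul_apply, smul_eq_mul, Pi.single_eq_of_ne hj, mul_zero,
      add_zero, Pi.zero_apply, ← Complex.ofReal_mul, Complex.ofReal_eq_zero] at hj0
    exact (by positivity : (a + 2 * r) * r ≠ 0) hj0
  refine ⟨hχm ▸ h_ne _, hχp ▸ h_ne _, ?_, ?_⟩
  · rw [hH, hχm]
    push_cast
    exact interpolated_reflections_mulVec huu hee hue heu hpaC hlam_sqC
  · rw [hH, hχp]
    push_cast
    simpa only [← sub_eq_add_neg, mul_neg, neg_neg] using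
      interpolated_reflections_mulVec huu hee hue heu hpaC
        (s := -(lamt : ℂ)) ((neg_sq _).trans hlam_sqC)
end

section
/- Let N ≥ 2 be a natural number and 0 < δ < 1/6 a real number. In ℂ^N, let u = (1/√N)·Σ_s e_s be the uniform superposition of the standard basis vectors, fix an index t with standard basis vector e_t, and define D = I − 2uu*, U_t = I − 2e_t e_t*, and H(τ) = (1−τ)D + τU_t for τ ∈ ℝ. Let τ_δ = 1/2 − N^{δ−1/2} and λ̃ = √(4 + N^{−2δ} − 4N^{−1}). Then every eigenvalue of H(τ_δ) equals −N^{δ−1/2}·λ̃, +N^{δ−1/2}·λ̃, or 1. -/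
open Matrix

/-- An eigenvalue `μ ≠ 1` of a rank-two perturbation of the identity is a root of the
characteristic polynomial of the induced map on the span of the two perturbing directions. -/
theorem eigenvalue_one_sub_rank_two {n K : Type*} [Fintype n] [DecidableEq n] [Field K]
    {p q μ : K} {x x' y y' w : n → K} (hw : w ≠ 0) (hμ : μ ≠ 1)
    (h : (1 - p • vecMulVec x x' - q • vecMulVec y y') *ᵥ w = μ • w) :
    (μ - 1 + p * (x' ⬝ᵥ x)) * (μ - 1 + q * (y' ⬝ᵥ y)) =
      p * q * (x' ⬝ᵥ y) * (y' ⬝ᵥ x) := by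
  have hμ' : μ - 1 ≠ 0 := sub_ne_zero.mpr hμ
  have key : (μ - 1) • w = -(p * (x' ⬝ᵥ w)) • x - (q * (y' ⬝ᵥ w)) • y := by
    rw [sub_smul, one_smul, ← h]
    ext i
    simp [sub_mulVec, smul_mulVec, vecMulVec_mulVec]
    ring
  have hx := congrArg (x' ⬝ᵥ ·) key
  have hy := congrArg (y' ⬝ᵥ ·) key
  simp only [dotProduct_sub, dotProduct_smul, smul_eq_mul] at hx hy
  by_cases hxw : x' ⬝ᵥ w = 0
  · by_cases hyw : y' ⬝ᵥ w = 0
    · simp [hxw, hyw, hμ', hw] at key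
    · apply mul_right_cancel₀ hyw
      linear_combination (μ - 1 + p * (x' ⬝ᵥ x)) * hy - p * (y' ⬝ᵥ x) * hx
  · apply mul_right_cancel₀ hxw
    linear_combination (μ - 1 + q * (y' ⬝ᵥ y)) * hx - q * (x' ⬝ᵥ y) * hy

/-- Spectrum of `H(τ_δ)` (Appendix B together with the invariance of `span{u, e_t}`):
every eigenvalue of `H(1/2 − N^{δ−1/2})` equals `−N^{δ−1/2}λ̃`, `+N^{δ−1/2}λ̃`, or `1`,
where `λ̃ = √(4 + N^{−2δ} − 4N^{−1})`. -/
theorem stmt_14 {N : ℕ} (hN : 2 ≤ N) (δ : ℝ) (hδ : 0 < δ) (hδ' : δ < 1/6) (t : Fin N)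
    (u et : Fin N → ℂ)
    (hu : u = fun _ => (((Real.sqrt N)⁻¹ : ℝ) : ℂ))
    (het : et = Pi.single t 1)
    (D Ut : Matrix (Fin N) (Fin N) ℂ)
    (hD : D = 1 - (2 : ℂ) • vecMulVec u (star u))
    (hUt : Ut = 1 - (2 : ℂ) • vecMulVec et (star et))
    (Hm : ℝ → Matrix (Fin N) (Fin N) ℂ)
    (hHm : ∀ τ : ℝ, Hm τ = (((1 - τ : ℝ)) : ℂ) • D + ((τ : ℝ) : ℂ) • Ut)
    (τδ lamt : ℝ)
    (hτδ : τδ = 1/2 - (N : ℝ) ^ (δ - 1/2 : ℝ))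
    (hlamt : lamt = Real.sqrt (4 + (N : ℝ) ^ (-(2 * δ) : ℝ) - 4 * (N : ℝ)⁻¹)) :
    ∀ μ : ℂ, Module.End.HasEigenvalue (Matrix.toLin' (Hm τδ)) μ →
      μ = ((-((N : ℝ) ^ (δ - 1/2 : ℝ) * lamt) : ℝ) : ℂ) ∨
      μ = (((N : ℝ) ^ (δ - 1/2 : ℝ) * lamt : ℝ) : ℂ) ∨
      μ = 1 := by
  intro μ hμ
  by_cases h1 : μ = 1
  · exact Or.inr (Or.inr h1)
  obtain ⟨w, hw⟩ := hμ.exists_hasEigenvector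
  have hHw : Hm τδ *ᵥ w = μ • w := by simpa using hw.apply_eq_smul
  have hN0 : (0 : ℝ) < N := by positivity
  set c : ℝ := (√N)⁻¹ with hc
  have hc2 : c ^ 2 = (N : ℝ)⁻¹ := by rw [hc, inv_pow, Real.sq_sqrt hN0.le]
  have hH : Hm τδ = 1 - ((2 * (1 - τδ) : ℝ) : ℂ) • vecMulVec u (star u)
      - ((2 * τδ : ℝ) : ℂ) • vecMulVec et (star et) := by
    rw [hHm, hD, hUt]
    push_cast
    module
  rw [hH] at hHw
  have hchar := eigenvalue_one_sub_rank_two hw.2 h1 hHw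
  have huu : star u ⬝ᵥ u = 1 := by
    have : (N : ℝ) * (c * c) = 1 := by rw [← pow_two, hc2, mul_inv_cancel₀ hN0.ne']
    simpa [hu, dotProduct] using congrArg (Complex.ofReal) this
  have hee : star et ⬝ᵥ et = 1 := by simp [het]
  have hue : star u ⬝ᵥ et = c := by simp [hu, het]
  have heu : star et ⬝ᵥ u = c := by simp [hu, het]
  rw [huu, hee, hue, heu] at hchar
  set x : ℝ := (N : ℝ) ^ (δ - 1/2 : ℝ) with hx
  have hx2 : x ^ 2 * (N : ℝ) ^ (-(2 * δ) : ℝ) = (N : ℝ)⁻¹ := by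
    rw [hx, ← Real.rpow_natCast, ← Real.rpow_mul hN0.le, ← Real.rpow_add hN0,
      ← Real.rpow_neg_one]
    congr 1
    push_cast
    ring
  have hlam2 : lamt ^ 2 = 4 + (N : ℝ) ^ (-(2 * δ) : ℝ) - 4 * (N : ℝ)⁻¹ := by
    rw [hlamt, Real.sq_sqrt]
    have hinv : (N : ℝ)⁻¹ ≤ 1 := inv_le_one_of_one_le₀ (by exact_mod_cast (by lia : 1 ≤ N))
    have := Real.rpow_nonneg hN0.le (-(2 * δ))
    linarith
  have hreal : (1 - 2 * τδ) ^ 2 + 4 * τδ * (1 - τδ) * c ^ 2 = (x * lamt) ^ 2 := by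
    rw [hc2, mul_pow, hlam2, hτδ]
    linear_combination -hx2
  have hsq : μ ^ 2 = ((x * lamt : ℝ) : ℂ) ^ 2 := by
    have hcomplex := congrArg Complex.ofReal hreal
    push_cast at hcomplex hchar ⊢
    linear_combination hchar + hcomplex
  rcases sq_eq_sq_iff_eq_or_eq_neg.mp hsq with h | h
  · exact Or.inr (Or.inl h)
  · exact Or.inl (by rw [h, Complex.ofReal_neg])
end
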